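/- arXiv:2004.10626 — 3 statements merged into one kernel-verified Lean document; each statement's English description precedes it below -/
import Mathlib

section
/- Let N ≥ 2 be an integer, let (μ_{ij})_{i≠j} be fixed real numbers, and define f_L : ℝ^N → ℝ^N by f_L(x)_i = 2x_i + L·sin(2πx_i) + Σ_{j≠i} μ_{ij}·sin(2π(x_j − x_i)). Then for every β ∈ (0, 1/3) there exist constants C_β > 0 and L₀ > 0 such that for all L ≥ L₀, the Lebesgue measure of the set B_β = {x ∈ [0,1]^N : |det Df_L(x)| ≤ L^{N−(1−β)}} is at most C_β · L^{−(1−3β)}. -/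
open MeasureTheory
open scoped Real

/-- Integrable majorant of `|cos (2πx)|^(-s)`. -/
noncomputable def gMaj (s x : ℝ) : ℝ := |x - 1 / 4| ^ (-s) + |x - 3 / 4| ^ (-s)

lemma gMaj_nonneg (s x : ℝ) : 0 ≤ gMaj s x := by
  unfold gMaj; positivity

lemma abs_rpow_intervalIntegrable {s : ℝ} (hs : s < 1) (a b : ℝ) :
    IntervalIntegrable (fun x : ℝ => |x| ^ (-s)) volume a b := by
  have key : ∀ c : ℝ, 0 ≤ c → IntervalIntegrable (fun x : ℝ => |x| ^ (-s)) volume 0 c := by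
    intro c hc
    have h := intervalIntegral.intervalIntegrable_rpow' (a := 0) (b := c) (r := -s) (by linarith)
    refine h.congr ?_
    intro x hx
    rw [Set.uIoc_of_le hc] at hx
    simp only [abs_of_pos hx.1]
  have key2 : ∀ c : ℝ, IntervalIntegrable (fun x : ℝ => |x| ^ (-s)) volume 0 c := by
    intro c
    rcases le_total 0 c with hc | hc
    · exact key c hc
    · rw [IntervalIntegrable.iff_comp_neg]
      simpa using key (-c) (by linarith)
  exact (key2 a).symm.trans (key2 b)

lemma gMaj_integrable {s : ℝ} (hs : s < 1) :
    Integrable (gMaj s) (volume.restrict (Set.Icc (0:ℝ) 1)) := by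
  have h : ∀ c : ℝ, Integrable (fun x : ℝ => |x - c| ^ (-s)) (volume.restrict (Set.Icc (0:ℝ) 1)) := by
    intro c
    have h1 := (abs_rpow_intervalIntegrable hs (0 - c) (1 - c)).comp_sub_right c
    have h2 : IntervalIntegrable (fun x : ℝ => |x - c| ^ (-s)) volume 0 1 := by
      simpa using h1
    exact (intervalIntegrable_iff_integrableOn_Icc_of_le zero_le_one).1 h2
  exact (h _).add (h _)

lemma cos_lower {y : ℝ} (c : ℝ) (hc : |Real.cos (2 * π * y)| = |Real.sin (2 * π * (y - c))|)
    (hy : |y - c| ≤ 1 / 4) : |y - c| ≤ |Real.cos (2 * π * y)| := by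
  have hpi := Real.pi_pos
  have h := Real.mul_abs_le_abs_sin (x := 2 * π * (y - c)) (by
    rw [abs_mul, abs_of_pos (by positivity)]; nlinarith)
  rw [← hc, abs_mul, abs_of_pos (by positivity : 0 < 2 * π)] at h
  have : 2 / π * (2 * π * |y - c|) = 4 * |y - c| := by field_simp; ring
  have := abs_nonneg (y - c)
  linarith

lemma cos_rpow_le {s x : ℝ} (hs : 0 ≤ s) (hx : x ∈ Set.Icc (0:ℝ) 1) (h1 : x ≠ 1 / 4)
    (h3 : x ≠ 3 / 4) :
    0 < |Real.cos (2 * π * x)| ∧ |Real.cos (2 * π * x)| ^ (-s) ≤ gMaj s x := by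
  have key : ∀ c : ℝ, x ≠ c → |x - c| ≤ |Real.cos (2 * π * x)| →
      |x - c| ^ (-s) ≤ gMaj s x →
      0 < |Real.cos (2 * π * x)| ∧ |Real.cos (2 * π * x)| ^ (-s) ≤ gMaj s x := by
    intro c hc hle hg
    have hp : 0 < |x - c| := abs_pos.2 (sub_ne_zero.2 hc)
    exact ⟨hp.trans_le hle, (Real.rpow_le_rpow_of_nonpos hp hle (by linarith)).trans hg⟩
  rcases le_total x (1 / 2) with h | h
  · refine key (1 / 4) h1 (cos_lower _ ?_ ?_) ?_
    · rw [show 2 * π * (x - 1 / 4) = 2 * π * x - π / 2 by ring, Real.sin_sub_pi_div_two, abs_neg]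
    · rw [abs_le]; constructor <;> linarith [hx.1]
    · unfold gMaj; linarith [Real.rpow_nonneg (abs_nonneg (x - 3 / 4)) (-s)]
  · refine key (3 / 4) h3 (cos_lower _ ?_ ?_) ?_
    · rw [show 2 * π * (x - 3 / 4) = 2 * π * x - π / 2 - π by ring, Real.sin_sub_pi,
        Real.sin_sub_pi_div_two, neg_neg]
    · rw [abs_le]; constructor <;> linarith [hx.2]
    · unfold gMaj; linarith [Real.rpow_nonneg (abs_nonneg (x - 1 / 4)) (-s)]

/-- Lower bound of determinants close to identity. -/
lemma det_near_one (N : ℕ) : ∃ ε : ℝ, 0 < ε ∧ ∀ E : Matrix (Fin N) (Fin N) ℝ,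
    (∀ i j, |E i j - (1 : Matrix (Fin N) (Fin N) ℝ) i j| < ε) → 1 / 2 < E.det := by
  have hc : Continuous (fun E : Fin N → Fin N → ℝ => Matrix.det (Matrix.of E)) :=
    Continuous.matrix_det continuous_id
  have h1 := hc.tendsto (fun i j => (1 : Matrix (Fin N) (Fin N) ℝ) i j)
  have h2 : Matrix.det (Matrix.of (fun i j => (1 : Matrix (Fin N) (Fin N) ℝ) i j)) = 1 := by
    exact Matrix.det_one
  rw [h2] at h1
  have h3 := h1.eventually (lt_mem_nhds (show (1/2 : ℝ) < 1 by norm_num))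
  obtain ⟨ε, hε, H⟩ := Metric.eventually_nhds_iff.1 h3
  refine ⟨ε, hε, fun E hE => ?_⟩
  refine @H (fun i j => E i j) ?_
  rw [dist_pi_lt_iff hε]
  intro i
  rw [dist_pi_lt_iff hε]
  intro j
  simpa [Real.dist_eq] using hE i j

lemma det_lower {N : ℕ} {ε K : ℝ} (hε : 0 < ε)
    (H : ∀ E : Matrix (Fin N) (Fin N) ℝ,
      (∀ i j, |E i j - (1 : Matrix (Fin N) (Fin N) ℝ) i j| < ε) → 1 / 2 < E.det)
    (d : Fin N → ℝ) (M : Matrix (Fin N) (Fin N) ℝ)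
    (hM : ∀ i j, |M i j - (if i = j then d i else 0)| ≤ K)
    (hd : ∀ i, K / ε < |d i|) (hK : 0 ≤ K) : 1 / 2 * ∏ i, |d i| ≤ |M.det| := by
  have hd0 : ∀ i, 0 < |d i| := fun i => lt_of_le_of_lt (by positivity) (hd i)
  have hd1 : ∀ i, d i ≠ 0 := fun i => abs_pos.1 (hd0 i)
  have h := H (Matrix.of fun i j => M i j / d i) (by
    intro i j
    have : M i j / d i - (1 : Matrix (Fin N) (Fin N) ℝ) i j
        = (M i j - (if i = j then d i else 0)) / d i := by
      rw [sub_div, Matrix.one_apply]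
      split_ifs <;> simp [hd1 i]
    rw [Matrix.of_apply, this, abs_div, div_lt_iff₀ (hd0 i)]
    have := hd i
    rw [div_lt_iff₀ hε] at this
    linarith [hM i j])
  have h2 : M = Matrix.of fun i j => d i * (Matrix.of fun i j => M i j / d i) i j := by
    ext i j
    simp only [Matrix.of_apply]
    field_simp [hd1 i]
  rw [h2, Matrix.det_mul_column, abs_mul, Finset.abs_prod, mul_comm]
  refine mul_le_mul_of_nonneg_left ?_ (Finset.prod_nonneg fun i _ => abs_nonneg _)
  exact h.le.trans (le_abs_self _)

lemma jac_bound {N : ℕ} (μ : Fin N → Fin N → ℝ) (L : ℝ) (x : Fin N → ℝ) (i j : Fin N) :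
    |fderiv ℝ (fun y : Fin N → ℝ => 2 * y i + L * Real.sin (2 * π * y i) +
        ∑ j, if j = i then 0 else μ i j * Real.sin (2 * π * (y j - y i))) x (Pi.single j 1)
      - (if i = j then 2 * π * L * Real.cos (2 * π * x i) else 0)| ≤
      2 + 2 * π * ∑ i, ∑ k, |μ i k| := by
  have hp : ∀ k : Fin N, HasFDerivAt (fun y : Fin N → ℝ => y k)
      (ContinuousLinearMap.proj (R := ℝ) (φ := fun _ : Fin N => ℝ) k) x :=
    fun k => hasFDerivAt_apply k x
  have hs : ∀ k : Fin N, HasFDerivAt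
      (fun y : Fin N → ℝ => if k = i then 0 else μ i k * Real.sin (2 * π * (y k - y i)))
      (if k = i then 0 else μ i k • (Real.cos (2 * π * (x k - x i)) • ((2 * π) •
        (ContinuousLinearMap.proj (R := ℝ) (φ := fun _ : Fin N => ℝ) k -
         ContinuousLinearMap.proj (R := ℝ) (φ := fun _ : Fin N => ℝ) i)))) x := by
    intro k
    by_cases hk : k = i
    · simp only [hk, if_true]; exact hasFDerivAt_const _ _
    · simp only [hk, if_false]
      exact ((((hp k).sub (hp i)).const_mul (2 * π)).sin).const_mul (μ i k)
  have hF := (((hp i).const_mul 2).add ((((hp i).const_mul (2 * π)).sin).const_mul L)).add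
    (HasFDerivAt.fun_sum (u := Finset.univ) (fun k _ => hs k))
  have hF' := hF.fderiv
  have e : (fun y : Fin N → ℝ => 2 * y i + L * Real.sin (2 * π * y i) +
        ∑ j, if j = i then 0 else μ i j * Real.sin (2 * π * (y j - y i))) =
     (((fun y : Fin N → ℝ => 2 * y i) + fun y => L * Real.sin (2 * π * y i)) +
        fun y => ∑ k, if k = i then 0 else μ i k * Real.sin (2 * π * (y k - y i))) := by
    funext y; simp
  rw [e, hF']
  set v : Fin N → ℝ := Pi.single j 1 with hv
  have hvb : ∀ k, 0 ≤ v k ∧ v k ≤ 1 := by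
    intro k
    rw [hv, Pi.single_apply]; split_ifs <;> norm_num
  have hvi : (if i = j then 2 * π * L * Real.cos (2 * π * x i) else 0) =
      2 * π * L * Real.cos (2 * π * x i) * v i := by
    rw [hv, Pi.single_apply]; split_ifs <;> simp
  rw [hvi]
  simp only [ContinuousLinearMap.add_apply, ContinuousLinearMap.smul_apply,
    ContinuousLinearMap.sum_apply, ContinuousLinearMap.proj_apply, smul_eq_mul]
  have hpi := Real.pi_pos
  have hb : ∀ k : Fin N, |(if k = i then (0 : (Fin N → ℝ) →L[ℝ] ℝ) else μ i k • (Real.cos (2 * π * (x k - x i)) • ((2 * π) •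
        (ContinuousLinearMap.proj (R := ℝ) (φ := fun _ : Fin N => ℝ) k -
         ContinuousLinearMap.proj (R := ℝ) (φ := fun _ : Fin N => ℝ) i)))) v| ≤ 2 * π * |μ i k| := by
    intro k
    split_ifs with hk
    · simp; positivity
    · simp only [ContinuousLinearMap.smul_apply, ContinuousLinearMap.sub_apply,
        ContinuousLinearMap.proj_apply, smul_eq_mul, abs_mul]
      have h1 : |v k - v i| ≤ 1 := by
        rw [abs_le]; constructor <;> linarith [(hvb k).1, (hvb k).2, (hvb i).1, (hvb i).2]
      have h2 := Real.abs_cos_le_one (2 * π * (x k - x i))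
      rw [abs_of_pos hpi, abs_two]
      have h3 : |Real.cos (2 * π * (x k - x i))| * |v k - v i| ≤ 1 :=
        mul_le_one₀ h2 (abs_nonneg _) h1
      calc _ = (2 * π * |μ i k|) * (|Real.cos (2 * π * (x k - x i))| * |v k - v i|) := by ring
        _ ≤ (2 * π * |μ i k|) * 1 := by gcongr
        _ = _ := by ring
  have hsum := (Finset.abs_sum_le_sum_abs _ Finset.univ).trans (Finset.sum_le_sum fun k _ => hb k)
  rw [← Finset.mul_sum] at hsum
  have hrow : ∑ k, |μ i k| ≤ ∑ i, ∑ k, |μ i k| :=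
    Finset.single_le_sum (f := fun i => ∑ k, |μ i k|)
      (fun i _ => Finset.sum_nonneg fun k _ => abs_nonneg _) (Finset.mem_univ i)
  have hrow' := mul_le_mul_of_nonneg_left hrow (show 0 ≤ 2 * π by positivity)
  have hv2 : |2 * v i| ≤ 2 := by rw [abs_le]; constructor <;> linarith [(hvb i).1, (hvb i).2]
  refine le_trans ?_ (add_le_add hv2 (hsum.trans hrow'))
  refine le_trans (le_of_eq ?_) (abs_add_le _ _)
  congr 1
  ring

lemma hyper_null (N : ℕ) :
    volume {x : Fin N → ℝ | ∃ i, x i = 1 / 4 ∨ x i = 3 / 4} = 0 := by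
  have : {x : Fin N → ℝ | ∃ i, x i = 1 / 4 ∨ x i = 3 / 4} =
      ⋃ i, ({x : Fin N → ℝ | x i = 1 / 4} ∪ {x | x i = 3 / 4}) := by
    ext x; simp
  rw [this]
  refine measure_iUnion_null fun i => measure_union_null ?_ ?_
  · exact Measure.pi_hyperplane (fun _ => volume) i _
  · exact Measure.pi_hyperplane (fun _ => volume) i _

lemma sublevel (N : ℕ) {s : ℝ} (hs0 : 0 ≤ s) (hs : s < 1) :
    ∃ I : ℝ, 0 ≤ I ∧ ∀ t : ℝ, 0 < t →
      volume {x : Fin N → ℝ | (∀ i, x i ∈ Set.Icc (0 : ℝ) 1) ∧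
        ∏ i, |Real.cos (2 * π * x i)| ≤ t} ≤ ENNReal.ofReal (I * t ^ s) := by
  set ν : Measure (Fin N → ℝ) := Measure.pi fun _ => volume.restrict (Set.Icc (0:ℝ) 1) with hν
  have hνr : ν = volume.restrict (Set.univ.pi fun _ => Set.Icc (0:ℝ) 1) := by
    rw [hν, volume_pi, Measure.restrict_pi_pi]
  have hint : Integrable (fun x : Fin N → ℝ => ∏ i, gMaj s (x i)) ν :=
    Integrable.fintype_prod (f := fun _ => gMaj s) (fun _ => gMaj_integrable hs)
  have hnn : ∀ x : Fin N → ℝ, 0 ≤ ∏ i, gMaj s (x i) :=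
    fun x => Finset.prod_nonneg fun i _ => gMaj_nonneg _ _
  refine ⟨∫ x, ∏ i, gMaj s (x i) ∂ν, integral_nonneg hnn, fun t ht => ?_⟩
  set Z := {x : Fin N → ℝ | ∃ i, x i = 1 / 4 ∨ x i = 3 / 4}
  set T := {x : Fin N → ℝ | t ^ (-s) ≤ ∏ i, gMaj s (x i)} with hT
  set Q : Set (Fin N → ℝ) := Set.univ.pi fun _ => Set.Icc (0:ℝ) 1 with hQ
  have hQm : MeasurableSet Q := MeasurableSet.univ_pi fun _ => measurableSet_Icc
  have hsub : {x : Fin N → ℝ | (∀ i, x i ∈ Set.Icc (0 : ℝ) 1) ∧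
        ∏ i, |Real.cos (2 * π * x i)| ≤ t} ⊆ Z ∪ (T ∩ Q) := by
    rintro x ⟨hx, hp⟩
    by_cases hz : x ∈ Z
    · exact Or.inl hz
    · right
      have hz' : ∀ i, x i ≠ 1 / 4 ∧ x i ≠ 3 / 4 := by
        intro i; constructor <;> intro h <;> exact hz ⟨i, by simp [h]⟩
      have hc := fun i => cos_rpow_le hs0 (hx i) (hz' i).1 (hz' i).2
      refine ⟨?_, fun i _ => hx i⟩
      have hpos : 0 < ∏ i, |Real.cos (2 * π * x i)| := Finset.prod_pos fun i _ => (hc i).1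
      calc t ^ (-s) ≤ (∏ i, |Real.cos (2 * π * x i)|) ^ (-s) :=
            Real.rpow_le_rpow_of_nonpos hpos hp (by linarith)
        _ = ∏ i, |Real.cos (2 * π * x i)| ^ (-s) :=
            (Real.finsetProd_rpow _ _ (fun i _ => abs_nonneg _) _).symm
        _ ≤ _ := Finset.prod_le_prod (fun i _ => Real.rpow_nonneg (abs_nonneg _) _)
            fun i _ => (hc i).2
  have hνT : volume (T ∩ Q) = ν T := by
    rw [hνr, Measure.restrict_apply' hQm]
  have hmk := mul_meas_ge_le_integral_of_nonneg (Filter.Eventually.of_forall hnn) hint (t ^ (-s))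
  have hfin : ν T ≠ ⊤ := by
    exact (hint.measure_ge_lt_top (Real.rpow_pos_of_pos ht _)).ne
  refine (measure_mono hsub).trans ((measure_union_le _ _).trans ?_)
  rw [hyper_null, zero_add, hνT]
  rw [← ENNReal.ofReal_toReal hfin]
  apply ENNReal.ofReal_le_ofReal
  have hts := Real.rpow_pos_of_pos ht s
  change t ^ (-s) * (ν T).toReal ≤ _ at hmk
  rw [Real.rpow_neg ht.le, inv_mul_le_iff₀ hts] at hmk
  linarith

/-- Condition (F2) for coupled standard maps: for the family
`f_L(x)_i = 2xᵢ + L sin(2πxᵢ) + ∑_{j≠i} μᵢⱼ sin(2π(xⱼ - xᵢ))` with Jacobian `J L x`,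
for every `β ∈ (0, 1/3)` there are `C_β > 0` and `L₀ > 0` such that for `L ≥ L₀` the set
`B_β = {x ∈ [0,1]^N : |det Df_L(x)| ≤ L^(N-(1-β))}` has Lebesgue measure at most
`C_β · L^(-(1-3β))`. -/
theorem statement8 (N : ℕ) (hN : 2 ≤ N) (μ : Fin N → Fin N → ℝ)
    (f : ℝ → (Fin N → ℝ) → Fin N → ℝ)
    (hf : ∀ (L : ℝ) (x : Fin N → ℝ) (i : Fin N),
      f L x i = 2 * x i + L * Real.sin (2 * π * x i) +
        ∑ j, if j = i then 0 else μ i j * Real.sin (2 * π * (x j - x i)))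
    (J : ℝ → (Fin N → ℝ) → Matrix (Fin N) (Fin N) ℝ)
    (hJ : ∀ (L : ℝ) (x : Fin N → ℝ) (i j : Fin N),
      J L x i j = fderiv ℝ (fun y => f L y i) x (Pi.single j 1)) :
    ∀ β : ℝ, β ∈ Set.Ioo (0 : ℝ) (1 / 3) →
      ∃ C : ℝ, 0 < C ∧ ∃ L₀ : ℝ, 0 < L₀ ∧ ∀ L : ℝ, L₀ ≤ L →
        volume {x : Fin N → ℝ |
            (∀ i, x i ∈ Set.Icc (0 : ℝ) 1) ∧ |(J L x).det| ≤ L ^ ((N : ℝ) - (1 - β))} ≤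
          ENNReal.ofReal (C * L ^ (-(1 - 3 * β))) := by
  rintro β ⟨hβ0, hβ1⟩
  set s : ℝ := (1 - 3 * β) / (1 - β) with hs
  have h1β : 0 < 1 - β := by linarith
  have hs0 : 0 ≤ s := div_nonneg (by linarith) h1β.le
  have hs1 : s < 1 := by rw [hs, div_lt_one h1β]; linarith
  obtain ⟨I, hI, hsubl⟩ := sublevel N hs0 hs1
  obtain ⟨ε, hε, hdet⟩ := det_near_one N
  set K : ℝ := 2 + 2 * π * ∑ i, ∑ k, |μ i k| with hKdef
  have hpi := Real.pi_pos
  have hpi3 := Real.pi_gt_three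
  have hK : 0 ≤ K := by positivity
  set A : ℝ := K / ε with hA
  have hA0 : 0 ≤ A := by positivity
  refine ⟨(I + 1) * (A + 2) ^ s, by positivity, 1, one_pos, fun L hL => ?_⟩
  have hL0 : 0 < L := by linarith
  have ht : 0 < (A + 2) * L ^ (β - 1) := by positivity
  have hmain := hsubl _ ht
  refine (measure_mono ?_).trans (hmain.trans (ENNReal.ofReal_le_ofReal ?_))
  · rintro x ⟨hx, hxd⟩
    refine ⟨hx, ?_⟩
    have hLb : 0 < L ^ (β - 1) := by positivity
    by_cases hd : ∀ i, A < |2 * π * L * Real.cos (2 * π * x i)|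
    · have hlow := det_lower hε hdet (fun i => 2 * π * L * Real.cos (2 * π * x i)) (J L x) (K := K)
        (by
          intro i j
          rw [hJ]
          have : (fun y => f L y i) = (fun y : Fin N → ℝ => 2 * y i + L * Real.sin (2 * π * y i) +
            ∑ j, if j = i then 0 else μ i j * Real.sin (2 * π * (y j - y i))) := by
            funext y; exact hf L y i
          rw [this]
          exact jac_bound μ L x i j) hd hK
      have hprod : L ^ N * ∏ i, |Real.cos (2 * π * x i)| ≤
          ∏ i, |2 * π * L * Real.cos (2 * π * x i)| := by
        have : L ^ N = ∏ _i : Fin N, L := by simp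
        rw [this, ← Finset.prod_mul_distrib]
        refine Finset.prod_le_prod (fun i _ => by positivity) fun i _ => ?_
        rw [abs_mul, abs_of_pos (by positivity : 0 < 2 * π * L)]
        refine mul_le_mul_of_nonneg_right ?_ (abs_nonneg _)
        nlinarith
      have e : L ^ ((N : ℝ) - (1 - β)) = L ^ N * L ^ (β - 1) := by
        rw [← Real.rpow_natCast, ← Real.rpow_add hL0]; congr 1; ring
      rw [e] at hxd
      have hLN : 0 < L ^ N := by positivity
      have h3 : L ^ N * ∏ i, |Real.cos (2 * π * x i)| ≤ L ^ N * (2 * L ^ (β - 1)) := by linarith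
      have h4 := le_of_mul_le_mul_left h3 hLN
      nlinarith
    · push Not at hd
      obtain ⟨i, hi⟩ := hd
      rw [abs_mul, abs_of_pos (by positivity : 0 < 2 * π * L)] at hi
      have h5 : ∏ i, |Real.cos (2 * π * x i)| ≤ |Real.cos (2 * π * x i)| := by
        rw [← Finset.mul_prod_erase Finset.univ _ (Finset.mem_univ i)]
        refine mul_le_of_le_one_right (abs_nonneg _) ?_
        exact Finset.prod_le_one (fun _ _ => abs_nonneg _) fun _ _ => Real.abs_cos_le_one _
      have h6 : L * |Real.cos (2 * π * x i)| ≤ A := by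
        refine le_trans (mul_le_mul_of_nonneg_right ?_ (abs_nonneg _)) hi
        nlinarith
      have h7 : |Real.cos (2 * π * x i)| ≤ A * L⁻¹ := by
        rw [← div_eq_mul_inv, le_div_iff₀ hL0]; linarith
      have h8 : L⁻¹ ≤ L ^ (β - 1) := by
        rw [← Real.rpow_neg_one]
        exact Real.rpow_le_rpow_of_exponent_le hL (by linarith)
      have h9 := mul_le_mul_of_nonneg_left h8 hA0
      linarith
  · have e : ((A + 2) * L ^ (β - 1)) ^ s = (A + 2) ^ s * L ^ (-(1 - 3 * β)) := by
      rw [Real.mul_rpow (by positivity) (by positivity), ← Real.rpow_mul hL0.le]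
      congr 2
      rw [hs]; field_simp; ring
    rw [e, ← mul_assoc]
    have : 0 < (A + 2) ^ s * L ^ (-(1 - 3 * β)) := by positivity
    linarith
end

section
/- Let N ≥ 1 and let A be an invertible 2N×2N real matrix and λ > 1. Assume: (i) for every N-dimensional subspace E ⊆ C^x_{1/10}, both A(E) ⊆ C^x_{1/10} and Aᵀ(E) ⊆ C^x_{1/10}; (ii) ‖Av‖ ≥ λ‖v‖ for all v ∈ C^x_{1/10}; (iii) ‖A^{-1}w‖ ≥ λ‖w‖ for all w ∈ C^y_{1/10}. Let h₁, …, h_{2N} and h₁', …, h_{2N}' be orthonormal bases of ℝ^{2N} with A·h_i = σ_i·h_i' where σ₁ ≥ σ₂ ≥ … ≥ σ_{2N} > 0 are the singular values of A. Then h_i, h_i' ∈ C^x_{1/10} for all 1 ≤ i ≤ N, and h_i, h_i' ∈ C^y_{1/10} for all N+1 ≤ i ≤ 2N. -/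
section Helpers

lemma le_of_sq_le_sq_aux {a b : ℝ} (h : a ^ 2 ≤ b ^ 2) (hb : 0 ≤ b) : a ≤ b :=
  abs_le_of_sq_le_sq' h hb |>.2

variable {V : Type*} [NormedAddCommGroup V] [InnerProductSpace ℝ V] [FiniteDimensional ℝ V]

lemma adj_coord {n : ℕ} (A : V →L[ℝ] V) (σ : Fin n → ℝ) (h h' : OrthonormalBasis (Fin n) ℝ V)
    (hsvd : ∀ i, A (h i) = σ i • h' i) (i : Fin n) (v : V) :
    inner ℝ (h' i) (A v) = σ i * inner ℝ (h i) v := by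
  conv_lhs => rw [← h.sum_repr' v]
  simp only [map_sum, map_smul, hsvd, inner_sum, inner_smul_right]
  rw [Finset.sum_eq_single i]
  · rw [orthonormal_iff_ite.mp h'.orthonormal i i]; simp; ring
  · intro j _ hj
    rw [orthonormal_iff_ite.mp h'.orthonormal i j, if_neg (Ne.symm hj)]; simp
  · simp

lemma norm_sq_coord {n : ℕ} (h : OrthonormalBasis (Fin n) ℝ V) (v : V) :
    ‖v‖ ^ 2 = ∑ i, (inner ℝ (h i) v) ^ 2 := by
  rw [← h.sum_sq_norm_inner_right v]
  simp

lemma norm_sq_map {n : ℕ} (A : V →L[ℝ] V) (σ : Fin n → ℝ) (h h' : OrthonormalBasis (Fin n) ℝ V)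
    (hsvd : ∀ i, A (h i) = σ i • h' i) (v : V) :
    ‖A v‖ ^ 2 = ∑ i, (σ i) ^ 2 * (inner ℝ (h i) v) ^ 2 := by
  rw [norm_sq_coord h' (A v)]
  refine Finset.sum_congr rfl fun i _ => ?_
  rw [adj_coord A σ h h' hsvd]; ring

lemma gram_coord {n : ℕ} (A : V →L[ℝ] V) (σ : Fin n → ℝ) (h h' : OrthonormalBasis (Fin n) ℝ V)
    (hsvd : ∀ i, A (h i) = σ i • h' i) (i : Fin n) (v : V) :
    inner ℝ (h i) (ContinuousLinearMap.adjoint A (A v)) = (σ i) ^ 2 * inner ℝ (h i) v := by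
  rw [ContinuousLinearMap.adjoint_inner_right, hsvd, real_inner_smul_left,
    adj_coord A σ h h' hsvd]; ring

/-- A subspace of dimension greater than `card ι` has a nonzero vector orthogonal to `ι`-many. -/
lemma exists_orth {ι : Type*} [Fintype ι] (E : Submodule ℝ V) (f : ι → V)
    (hlt : Fintype.card ι < Module.finrank ℝ E) :
    ∃ v ∈ E, v ≠ 0 ∧ ∀ k, inner ℝ (f k) v = 0 := by
  let L : E →ₗ[ℝ] (ι → ℝ) := LinearMap.pi fun k => (innerₛₗ ℝ (f k)).comp E.subtype
  have hk : LinearMap.ker L ≠ ⊥ := by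
    apply LinearMap.ker_ne_bot_of_finrank_lt
    simpa using hlt
  obtain ⟨v, hv, hv0⟩ := Submodule.exists_mem_ne_zero_of_ne_bot hk
  refine ⟨v, v.2, by simpa using hv0, fun k => ?_⟩
  have := congrFun (LinearMap.mem_ker.mp hv) k
  simpa [L] using this

lemma top_ge {N : ℕ} (A : V →L[ℝ] V) (σ : Fin (2 * N) → ℝ)
    (h h' : OrthonormalBasis (Fin (2 * N)) ℝ V)
    (hsvd : ∀ i, A (h i) = σ i • h' i) (hσ : Antitone σ) (hσpos : ∀ i, 0 < σ i)
    (E : Submodule ℝ V) (hE : Module.finrank ℝ E = N) (lam : ℝ) (hlam : 1 < lam)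
    (hexp : ∀ v ∈ E, lam * ‖v‖ ≤ ‖A v‖) (i : Fin (2 * N)) (hi : (i : ℕ) < N) : lam ≤ σ i := by
  obtain ⟨v, hvE, hv0, hv⟩ := exists_orth E (fun k : Fin i => h ⟨k, by omega⟩) (by simpa [hE])
  have h1 := hexp v hvE
  have hvpos : 0 < ‖v‖ := norm_pos_iff.mpr hv0
  have h2 : ‖A v‖ ^ 2 ≤ (σ i * ‖v‖) ^ 2 := by
    rw [norm_sq_map A σ h h' hsvd, mul_pow, norm_sq_coord h v, Finset.mul_sum]
    refine Finset.sum_le_sum fun j _ => ?_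
    by_cases hj : (j : ℕ) < i
    · have := hv ⟨j, hj⟩
      simp only [Fin.eta] at this
      simp [this]
    · have : σ j ≤ σ i := hσ (Fin.le_def.mpr (not_lt.mp hj))
      have := hσpos j
      gcongr
  have h3 : ‖A v‖ ≤ σ i * ‖v‖ :=
    le_of_sq_le_sq_aux h2 (by have := hσpos i; positivity)
  exact le_of_mul_le_mul_right (h1.trans h3) hvpos

lemma bottom_sv_le {N : ℕ} (A : V →L[ℝ] V) (σ : Fin (2 * N) → ℝ)
    (h h' : OrthonormalBasis (Fin (2 * N)) ℝ V)
    (hsvd : ∀ i, A (h i) = σ i • h' i) (hσ : Antitone σ) (hσpos : ∀ i, 0 < σ i)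
    (E : Submodule ℝ V) (hE : Module.finrank ℝ E = N) (lam : ℝ) (hlam : 1 < lam)
    (hexp : ∀ v ∈ E, lam * ‖A v‖ ≤ ‖v‖) (i : Fin (2 * N)) (hi : N ≤ (i : ℕ)) : σ i ≤ 1 := by
  obtain ⟨v, hvE, hv0, hv⟩ := exists_orth E
    (fun k : Fin (2 * N - 1 - i) => h ⟨i + 1 + k, by omega⟩) (by simp [hE]; omega)
  have h1 := hexp v hvE
  have hvpos : 0 < ‖v‖ := norm_pos_iff.mpr hv0
  have h2 : (σ i * ‖v‖) ^ 2 ≤ ‖A v‖ ^ 2 := by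
    rw [norm_sq_map A σ h h' hsvd, mul_pow, norm_sq_coord h v, Finset.mul_sum]
    refine Finset.sum_le_sum fun j _ => ?_
    by_cases hj : (i : ℕ) < j
    · have := hv ⟨j - (i + 1), by omega⟩
      have e : (⟨i + 1 + (j - (i + 1)), by omega⟩ : Fin (2 * N)) = j := by
        ext; simp; omega
      simp only [e] at this
      simp [this]
    · have : σ i ≤ σ j := hσ (Fin.le_def.mpr (not_lt.mp hj))
      have := hσpos i
      gcongr
  have h3 : σ i * ‖v‖ ≤ ‖A v‖ := le_of_sq_le_sq_aux h2 (by positivity)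
  have h4 : ‖A v‖ ≤ ‖v‖ := by nlinarith [norm_nonneg (A v)]
  have h5 : σ i * ‖v‖ ≤ 1 * ‖v‖ := by linarith
  exact le_of_mul_le_mul_right h5 hvpos

/-- top part of the squared norm -/
noncomputable def topSq {N : ℕ} (h : OrthonormalBasis (Fin (2 * N)) ℝ V) (v : V) : ℝ :=
  ∑ i : Fin (2 * N), if (i : ℕ) < N then (inner ℝ (h i) v) ^ 2 else 0

/-- bottom part of the squared norm -/
noncomputable def botSq {N : ℕ} (h : OrthonormalBasis (Fin (2 * N)) ℝ V) (v : V) : ℝ :=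
  ∑ i : Fin (2 * N), if (i : ℕ) < N then 0 else (inner ℝ (h i) v) ^ 2

lemma topSq_add_botSq {N : ℕ} (h : OrthonormalBasis (Fin (2 * N)) ℝ V) (v : V) :
    topSq h v + botSq h v = ‖v‖ ^ 2 := by
  rw [norm_sq_coord h, topSq, botSq, ← Finset.sum_add_distrib]
  refine Finset.sum_congr rfl fun i _ => ?_
  split_ifs <;> simp

lemma topSq_nonneg {N : ℕ} (h : OrthonormalBasis (Fin (2 * N)) ℝ V) (v : V) : 0 ≤ topSq h v :=
  Finset.sum_nonneg fun i _ => by split_ifs <;> positivity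

lemma botSq_nonneg {N : ℕ} (h : OrthonormalBasis (Fin (2 * N)) ℝ V) (v : V) : 0 ≤ botSq h v :=
  Finset.sum_nonneg fun i _ => by split_ifs <;> positivity

/-- The iterated subspaces. -/
lemma iter_space {N : ℕ} (hN : 1 ≤ N) (A : V →L[ℝ] V) (σ : Fin (2 * N) → ℝ)
    (h h' : OrthonormalBasis (Fin (2 * N)) ℝ V)
    (hsvd : ∀ i, A (h i) = σ i • h' i) (hσ : Antitone σ) (hσpos : ∀ i, 0 < σ i)
    (hA : Function.Injective A)
    (lam : ℝ) (hlam : 1 < lam) (Cx : Set V)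
    (hexp : ∀ v ∈ Cx, lam * ‖v‖ ≤ ‖A v‖)
    (htop : ∀ i : Fin (2 * N), (i : ℕ) < N → lam ≤ σ i)
    (hbot : ∀ i : Fin (2 * N), N ≤ (i : ℕ) → σ i ≤ 1)
    (hconeA : ∀ E : Submodule ℝ V,
      Module.finrank ℝ E = N → (E : Set _) ⊆ Cx →
        (A '' E ⊆ Cx ∧ (ContinuousLinearMap.adjoint A) '' E ⊆ Cx))
    (E : Submodule ℝ V) (hE : Module.finrank ℝ E = N) (hEC : (E : Set V) ⊆ Cx) :
    ∃ C : ℝ, 0 ≤ C ∧ ∀ n : ℕ, ∃ F : Submodule ℝ V, Module.finrank ℝ F = N ∧ (F : Set V) ⊆ Cx ∧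
      ∀ v ∈ F, botSq h v ≤ C * ((lam ^ 4)⁻¹) ^ n * topSq h v := by
  let S := σ ⟨0, by omega⟩
  have hl2 : 0 < lam ^ 2 - 1 := by nlinarith
  refine ⟨S ^ 2 / (lam ^ 2 - 1), by positivity, fun n => ?_⟩
  induction n with
  | zero =>
    refine ⟨E, hE, hEC, fun v hv => ?_⟩
    have h1 := hexp v (hEC hv)
    have h2 : (lam * ‖v‖) ^ 2 ≤ ‖A v‖ ^ 2 := by gcongr
    have h3 : ‖A v‖ ^ 2 ≤ S ^ 2 * topSq h v + botSq h v := by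
      rw [norm_sq_map A σ h h' hsvd, topSq, botSq, Finset.mul_sum, ← Finset.sum_add_distrib]
      refine Finset.sum_le_sum fun j _ => ?_
      have hp := hσpos j
      split_ifs with hj
      · have : σ j ≤ S := hσ (by simp [Fin.le_def])
        rw [add_zero]
        gcongr
      · have h1 := hbot j (by omega)
        have : σ j ^ 2 ≤ 1 := by nlinarith
        nlinarith [sq_nonneg (inner ℝ (h j) v)]
    rw [mul_pow, ← topSq_add_botSq h v] at h2
    rw [pow_zero, mul_one, div_mul_eq_mul_div, le_div_iff₀ hl2]
    have := topSq_nonneg h v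
    nlinarith
  | succ n ih =>
    obtain ⟨F, hF, hFC, hb⟩ := ih
    let B : V →ₗ[ℝ] V := ((ContinuousLinearMap.adjoint A).comp A : V →L[ℝ] V)
    have hBv : ∀ v, B v = ContinuousLinearMap.adjoint A (A v) := fun v => rfl
    have hB : Function.Injective B := by
      rw [injective_iff_map_eq_zero]
      intro v hv
      apply hA
      rw [map_zero]
      have : inner ℝ (A v) (A v) = 0 := by
        rw [← ContinuousLinearMap.adjoint_inner_right, ← hBv, hv, inner_zero_right]
      exact inner_self_eq_zero.mp this
    have hc1 := (hconeA F hF hFC).1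
    have hF1 : Module.finrank ℝ (F.map (A : V →ₗ[ℝ] V)) = N := by
      rw [← hF]
      exact ((Submodule.equivMapOfInjective (A : V →ₗ[ℝ] V) hA F).finrank_eq).symm
    have hc2 := (hconeA (F.map (A : V →ₗ[ℝ] V)) hF1 (by simpa using hc1)).2
    refine ⟨F.map B, ?_, ?_, ?_⟩
    · rw [← hF]
      exact ((Submodule.equivMapOfInjective B hB F).finrank_eq).symm
    · rintro _ ⟨v, hv, rfl⟩
      exact hc2 ⟨A v, ⟨v, hv, rfl⟩, rfl⟩
    · rintro _ ⟨v, hv, rfl⟩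
      have h1 := hb v hv
      have hl4 : 0 < lam ^ 4 := by positivity
      have h2 : botSq h (B v) ≤ botSq h v := by
        refine Finset.sum_le_sum fun j _ => ?_
        split_ifs with hj
        · exact le_rfl
        · rw [hBv, gram_coord A σ h h' hsvd]
          have h1 := hbot j (by omega)
          have hp := hσpos j
          have h3 : (σ j ^ 2) ^ 2 ≤ 1 := by
            rw [← pow_mul]; exact pow_le_one₀ hp.le h1
          nlinarith [sq_nonneg (inner ℝ (h j) v)]
      have h3 : lam ^ 4 * topSq h v ≤ topSq h (B v) := by
        rw [topSq, topSq, Finset.mul_sum]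
        refine Finset.sum_le_sum fun j _ => ?_
        split_ifs with hj
        · rw [hBv, gram_coord A σ h h' hsvd, mul_pow, ← pow_mul]
          have := htop j hj
          gcongr
        · simp
      have h4 : topSq h v ≤ (lam ^ 4)⁻¹ * topSq h (B v) := by
        rw [inv_mul_eq_div, le_div_iff₀ hl4]; linarith
      calc botSq h (B v) ≤ botSq h v := h2
        _ ≤ _ := h1
        _ ≤ S ^ 2 / (lam ^ 2 - 1) * ((lam ^ 4)⁻¹) ^ n * ((lam ^ 4)⁻¹ * topSq h (B v)) := by
            gcongr
        _ = _ := by ring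

/-- Vectors with no bottom part lie in the cone. -/
lemma top_mem {N : ℕ} (h : OrthonormalBasis (Fin (2 * N)) ℝ V)
    (lam : ℝ) (hlam : 1 < lam) (Cx : Set V) (hcl : IsClosed Cx) (C : ℝ) (hC : 0 ≤ C)
    (H : ∀ n : ℕ, ∃ F : Submodule ℝ V, Module.finrank ℝ F = N ∧ (F : Set V) ⊆ Cx ∧
      ∀ v ∈ F, botSq h v ≤ C * ((lam ^ 4)⁻¹) ^ n * topSq h v)
    (t : V) (ht : ∀ i : Fin (2 * N), N ≤ (i : ℕ) → inner ℝ (h i) t = 0) : t ∈ Cx := by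
  have key : ∀ n : ℕ, ∃ e ∈ Cx, ‖e - t‖ ^ 2 ≤ C * ((lam ^ 4)⁻¹) ^ n * topSq h t := by
    intro n
    obtain ⟨F, hF, hFC, hb⟩ := H n
    let L : F →ₗ[ℝ] (Fin N → ℝ) :=
      LinearMap.pi fun k => (innerₛₗ ℝ (h ⟨k, by omega⟩)).comp F.subtype
    have hL : ∀ (v : F) (k : Fin N), L v k = inner ℝ (h ⟨k, by omega⟩) (v : V) := fun v k => rfl
    have hinj : Function.Injective L := by
      rw [injective_iff_map_eq_zero]
      intro v hv
      have h0 : topSq h (v : V) = 0 := by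
        refine Finset.sum_eq_zero fun i _ => ?_
        split_ifs with hi
        · have := congrFun hv ⟨i, hi⟩
          rw [hL] at this
          simp only [Fin.eta, Pi.zero_apply] at this
          simp [this]
        · rfl
      have h1 := hb v v.2
      rw [h0, mul_zero] at h1
      have h2 := topSq_add_botSq h (v : V)
      have h3 : ‖(v : V)‖ ^ 2 = 0 := le_antisymm (by linarith) (by positivity)
      have h4 : (v : V) = 0 := by simpa using h3
      exact Subtype.ext h4
    have hsurj : Function.Surjective L :=
      (LinearMap.injective_iff_surjective_of_finrank_eq_finrank (by simp [hF])).mp hinj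
    obtain ⟨e, he⟩ := hsurj fun k => inner ℝ (h ⟨k, by omega⟩) t
    have het : ∀ i : Fin (2 * N), (i : ℕ) < N → inner ℝ (h i) (e : V) = inner ℝ (h i) t := by
      intro i hi
      have := congrFun he ⟨i, hi⟩
      rw [hL] at this
      simpa using this
    refine ⟨e, hFC e.2, ?_⟩
    have h1 : ‖(e : V) - t‖ ^ 2 = botSq h (e : V) := by
      rw [norm_sq_coord h, botSq]
      refine Finset.sum_congr rfl fun i _ => ?_
      rw [inner_sub_right]
      split_ifs with hi
      · rw [het i hi]; simp
      · rw [ht i (by omega)]; simp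
    have h2 : topSq h (e : V) = topSq h t := by
      refine Finset.sum_congr rfl fun i _ => ?_
      split_ifs with hi
      · rw [het i hi]
      · rfl
    rw [h1, ← h2]
    exact hb e e.2
  choose e he hle using key
  have hl : (lam ^ 4)⁻¹ < 1 := inv_lt_one_of_one_lt₀ (one_lt_pow₀ hlam (by norm_num))
  have hlim : Filter.Tendsto (fun n : ℕ => C * ((lam ^ 4)⁻¹) ^ n * topSq h t)
      Filter.atTop (nhds 0) := by
    have := ((tendsto_pow_atTop_nhds_zero_of_lt_one (by positivity) hl).const_mul C).mul_const
      (topSq h t)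
    simpa using this
  have h1 : Filter.Tendsto (fun n => ‖e n - t‖ ^ 2) Filter.atTop (nhds 0) :=
    squeeze_zero (fun n => by positivity) hle hlim
  have h2 : Filter.Tendsto (fun n => ‖e n - t‖) Filter.atTop (nhds 0) := by
    have := h1.sqrt
    simpa using this
  exact hcl.mem_of_tendsto (tendsto_iff_norm_sub_tendsto_zero.mpr h2)
    (Filter.Eventually.of_forall he)

/-- The span of the first `N` basis vectors. -/
lemma span_top {N : ℕ} (h : OrthonormalBasis (Fin (2 * N)) ℝ V) :
    ∃ T : Submodule ℝ V, Module.finrank ℝ T = N ∧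
      (∀ i : Fin (2 * N), (i : ℕ) < N → h i ∈ T) ∧
      ∀ t ∈ T, ∀ i : Fin (2 * N), N ≤ (i : ℕ) → inner ℝ (h i) t = 0 := by
  let f : Fin N → V := fun k => h ⟨k, by omega⟩
  have hf : LinearIndependent ℝ f :=
    h.orthonormal.linearIndependent.comp (fun k : Fin N => (⟨k, by omega⟩ : Fin (2 * N)))
      (fun a b hab => by simpa [Fin.ext_iff] using hab)
  refine ⟨Submodule.span ℝ (Set.range f), ?_, ?_, ?_⟩
  · rw [finrank_span_eq_card hf]; simp
  · intro i hi
    exact Submodule.subset_span ⟨⟨i, hi⟩, rfl⟩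
  · intro t ht i hi
    induction ht using Submodule.span_induction with
    | mem x hx =>
      obtain ⟨k, rfl⟩ := hx
      apply h.orthonormal.2
      intro hk
      rw [Fin.ext_iff] at hk
      simp at hk
      omega
    | zero => simp
    | add x y _ _ hx hy => rw [inner_add_right, hx, hy, add_zero]
    | smul a x _ hx => rw [inner_smul_right, hx, mul_zero]

end Helpers

lemma perp_cone (N : ℕ)
    (E : Submodule ℝ (WithLp 2 (EuclideanSpace ℝ (Fin N) × EuclideanSpace ℝ (Fin N))))
    (hE : Module.finrank ℝ E = N) (hEC : ∀ w ∈ E, ‖w.snd‖ ≤ (1 / 10) * ‖w.fst‖)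
    (x : WithLp 2 (EuclideanSpace ℝ (Fin N) × EuclideanSpace ℝ (Fin N)))
    (hx : ∀ w ∈ E, inner ℝ x w = 0) : ‖x.fst‖ ≤ (1 / 10) * ‖x.snd‖ := by
  let L : E →ₗ[ℝ] EuclideanSpace ℝ (Fin N) :=
    (LinearMap.fst ℝ _ _).comp ((WithLp.linearEquiv 2 ℝ
      (EuclideanSpace ℝ (Fin N) × EuclideanSpace ℝ (Fin N))).toLinearMap.comp E.subtype)
  have hL : ∀ v : E, L v = (v : WithLp 2 (EuclideanSpace ℝ (Fin N) × EuclideanSpace ℝ (Fin N))).fst := fun v => rfl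
  have hinj : Function.Injective L := by
    rw [injective_iff_map_eq_zero]
    intro v hv
    rw [hL] at hv
    have h1 := hEC v v.2
    rw [hv, norm_zero, mul_zero] at h1
    have h2 : (v : WithLp 2 (EuclideanSpace ℝ (Fin N) × EuclideanSpace ℝ (Fin N))).snd = 0 :=
      norm_le_zero_iff.mp h1
    have h3 := WithLp.prod_norm_sq_eq_of_L2 (v : WithLp 2 (EuclideanSpace ℝ (Fin N) × EuclideanSpace ℝ (Fin N)))
    rw [hv, h2] at h3
    apply Subtype.ext
    simpa using h3
  have hsurj : Function.Surjective L :=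
    (LinearMap.injective_iff_surjective_of_finrank_eq_finrank (by simp [hE])).mp hinj
  obtain ⟨e, he⟩ := hsurj x.fst
  rw [hL] at he
  have h1 := hx e e.2
  rw [WithLp.prod_inner_apply] at h1
  have h2 := hEC e e.2
  change inner ℝ x.fst (e : WithLp 2 (EuclideanSpace ℝ (Fin N) × EuclideanSpace ℝ (Fin N))).fst + inner ℝ x.snd (e : WithLp 2 (EuclideanSpace ℝ (Fin N) × EuclideanSpace ℝ (Fin N))).snd = 0 at h1
  rw [he, real_inner_self_eq_norm_sq] at h1
  rw [he] at h2
  have h3 := abs_le.mp (abs_real_inner_le_norm x.snd (e : WithLp 2 (EuclideanSpace ℝ (Fin N) × EuclideanSpace ℝ (Fin N))).snd)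
  have h4 : ‖x.fst‖ ^ 2 ≤ ‖x.snd‖ * ((1 / 10) * ‖x.fst‖) :=
    (by linarith [h3.1] : ‖x.fst‖ ^ 2 ≤ ‖x.snd‖ * _).trans
      (mul_le_mul_of_nonneg_left h2 (norm_nonneg _))
  rcases (norm_nonneg x.fst).eq_or_lt with h0 | h0
  · rw [← h0]; positivity
  · nlinarith

/-- Singular directions of a cone-hyperbolic map: on
`ℝ^{2N} = ℝ^N × ℝ^N` with the Euclidean (L²) product norm, let `A` be an invertible linear
map such that every `N`-dimensional subspace of the horizontal cone `C^x_{1/10}` is mapped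
into `C^x_{1/10}` by both `A` and `Aᵀ`, with `‖Av‖ ≥ λ‖v‖` on `C^x_{1/10}` and
`‖A⁻¹w‖ ≥ λ‖w‖` on `C^y_{1/10}` for some `λ > 1`. If `A hᵢ = σᵢ hᵢ'` is a singular value
decomposition (`h, h'` orthonormal bases, `σ₁ ≥ ⋯ ≥ σ_{2N} > 0` the singular values), then
`hᵢ, hᵢ' ∈ C^x_{1/10}` for `1 ≤ i ≤ N` and `hᵢ, hᵢ' ∈ C^y_{1/10}` for `N+1 ≤ i ≤ 2N`. -/
theorem statement13 (N : ℕ) (hN : 1 ≤ N)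
    (A : WithLp 2 (EuclideanSpace ℝ (Fin N) × EuclideanSpace ℝ (Fin N)) →L[ℝ]
         WithLp 2 (EuclideanSpace ℝ (Fin N) × EuclideanSpace ℝ (Fin N)))
    (hA : Function.Bijective A)
    (lam : ℝ) (hlam : 1 < lam)
    (Cx Cy : Set (WithLp 2 (EuclideanSpace ℝ (Fin N) × EuclideanSpace ℝ (Fin N))))
    (hCx : Cx = {w | ‖(WithLp.equiv 2 (EuclideanSpace ℝ (Fin N) × EuclideanSpace ℝ (Fin N)) w).2‖
        ≤ (1 / 10) * ‖(WithLp.equiv 2 (EuclideanSpace ℝ (Fin N) × EuclideanSpace ℝ (Fin N)) w).1‖})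
    (hCy : Cy = {w | ‖(WithLp.equiv 2 (EuclideanSpace ℝ (Fin N) × EuclideanSpace ℝ (Fin N)) w).1‖
        ≤ (1 / 10) * ‖(WithLp.equiv 2 (EuclideanSpace ℝ (Fin N) × EuclideanSpace ℝ (Fin N)) w).2‖})
    (hconeA : ∀ E : Submodule ℝ (WithLp 2 (EuclideanSpace ℝ (Fin N) × EuclideanSpace ℝ (Fin N))),
      Module.finrank ℝ E = N → (E : Set _) ⊆ Cx →
        (A '' E ⊆ Cx ∧ (ContinuousLinearMap.adjoint A) '' E ⊆ Cx))
    (hexp : ∀ v ∈ Cx, lam * ‖v‖ ≤ ‖A v‖)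
    (hcontr : ∀ v, A v ∈ Cy → lam * ‖A v‖ ≤ ‖v‖)
    (σ : Fin (2 * N) → ℝ)
    (h h' : OrthonormalBasis (Fin (2 * N)) ℝ
      (WithLp 2 (EuclideanSpace ℝ (Fin N) × EuclideanSpace ℝ (Fin N))))
    (hσ : Antitone σ) (hσpos : ∀ i, 0 < σ i)
    (hsvd : ∀ i, A (h i) = σ i • h' i) :
    ∀ i : Fin (2 * N),
      ((i : ℕ) < N → h i ∈ Cx ∧ h' i ∈ Cx) ∧
      (N ≤ (i : ℕ) → h i ∈ Cy ∧ h' i ∈ Cy) := by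
  have hCx' : ∀ w, w ∈ Cx ↔ ‖w.snd‖ ≤ (1 / 10) * ‖w.fst‖ := fun w => by rw [hCx]; rfl
  have hCy' : ∀ w, w ∈ Cy ↔ ‖w.fst‖ ≤ (1 / 10) * ‖w.snd‖ := fun w => by rw [hCy]; rfl
  have hcl : IsClosed Cx := by
    have : Cx = {w | ‖w.snd‖ ≤ (1 / 10) * ‖w.fst‖} := Set.ext hCx'
    rw [this]
    exact isClosed_le (by fun_prop) (by fun_prop)
  let le := (WithLp.linearEquiv 2 ℝ (EuclideanSpace ℝ (Fin N) × EuclideanSpace ℝ (Fin N)))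
  let ix := le.symm.toLinearMap.comp
    (LinearMap.inl ℝ (EuclideanSpace ℝ (Fin N)) (EuclideanSpace ℝ (Fin N)))
  let iy := le.symm.toLinearMap.comp
    (LinearMap.inr ℝ (EuclideanSpace ℝ (Fin N)) (EuclideanSpace ℝ (Fin N)))
  have hix : Module.finrank ℝ (LinearMap.range ix) = N := by
    have hinj : Function.Injective ix := le.symm.injective.comp LinearMap.inl_injective
    rw [LinearMap.finrank_range_of_inj hinj]; simp
  have hiy : Module.finrank ℝ (LinearMap.range iy) = N := by
    have hinj : Function.Injective iy := le.symm.injective.comp LinearMap.inr_injective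
    rw [LinearMap.finrank_range_of_inj hinj]; simp
  have hixC : (LinearMap.range ix : Set _) ⊆ Cx := by
    rintro _ ⟨u, rfl⟩
    rw [hCx']
    have : (ix u).snd = 0 := rfl
    rw [this, norm_zero]; positivity
  have hiyC : (LinearMap.range iy : Set _) ⊆ Cy := by
    rintro _ ⟨u, rfl⟩
    rw [hCy']
    have : (iy u).fst = 0 := rfl
    rw [this, norm_zero]; positivity
  have htop := top_ge A σ h h' hsvd hσ hσpos _ hix lam hlam (fun v hv => hexp v (hixC hv))
  let Al : WithLp 2 (EuclideanSpace ℝ (Fin N) × EuclideanSpace ℝ (Fin N)) →ₗ[ℝ]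
      WithLp 2 (EuclideanSpace ℝ (Fin N) × EuclideanSpace ℝ (Fin N)) := A.toLinearMap
  let Ae := LinearEquiv.ofBijective Al hA
  have hW : Module.finrank ℝ ((LinearMap.range iy).map Ae.symm.toLinearMap) = N := by
    refine Eq.trans ?_ hiy
    exact ((Submodule.equivMapOfInjective Ae.symm.toLinearMap Ae.symm.injective _).finrank_eq).symm
  have hbot := bottom_sv_le A σ h h' hsvd hσ hσpos _ hW lam hlam (by
    rintro _ ⟨w, hw, rfl⟩
    apply hcontr
    have : A (Ae.symm w) = w := Ae.apply_symm_apply w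
    change A (Ae.symm w) ∈ Cy
    rw [this]
    exact hiyC hw)
  obtain ⟨C, hC, H⟩ := iter_space hN A σ h h' hsvd hσ hσpos hA.1 lam hlam Cx hexp htop hbot
    hconeA _ hix hixC
  obtain ⟨T, hT, hTm, hTo⟩ := span_top h
  have hTC : (T : Set _) ⊆ Cx := fun t ht => top_mem h lam hlam Cx hcl C hC H t (hTo t ht)
  have hAT := (hconeA T hT hTC).1
  have hT' : Module.finrank ℝ (T.map Al) = N := by
    refine Eq.trans ?_ hT
    exact ((Submodule.equivMapOfInjective Al hA.1 T).finrank_eq).symm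
  intro i
  refine ⟨fun hi => ⟨hTC (hTm i hi), ?_⟩, fun hi => ⟨?_, ?_⟩⟩
  · have h1 : A (h i) ∈ Cx := hAT ⟨h i, hTm i hi, rfl⟩
    rw [hsvd, hCx', WithLp.smul_snd, WithLp.smul_fst, norm_smul, norm_smul] at h1
    rw [hCx']
    have h2 : 0 < ‖σ i‖ := norm_pos_iff.mpr (hσpos i).ne'
    refine le_of_mul_le_mul_left ?_ h2
    linarith
  · rw [hCy']
    exact perp_cone N T hT (fun w hw => (hCx' w).mp (hTC hw)) (h i) (fun w hw => hTo w hw i hi)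
  · rw [hCy']
    refine perp_cone N _ hT' ?_ (h' i) ?_
    · rintro _ ⟨w, hw, rfl⟩
      exact (hCx' _).mp (hAT ⟨w, hw, rfl⟩)
    · rintro _ ⟨w, hw, rfl⟩
      have := adj_coord A σ h h' hsvd i w
      rw [hTo w hw i hi, mul_zero] at this
      exact this
end

section
/- Let d ≥ 1 and 1 ≤ k < d. Let C ⊆ ℝ^d be a closed cone (i.e. C is closed and sv ∈ C for every s ∈ ℝ and v ∈ C) that contains at least one k-dimensional linear subspace. Let A be an invertible d×d real matrix with the property that for every k-dimensional subspace E ⊆ C, both A(E) ⊆ C and Aᵀ(E) ⊆ C. Then there exist orthonormal bases e₁, …, e_d and e₁', …, e_d' of ℝ^d with A·e_i = σ_i(A)·e_i' for all i (where σ₁(A) ≥ … ≥ σ_d(A) are the singular values of A), and indices 1 ≤ i₁ < i₂ < … < i_k ≤ d, such that e_{i_j} ∈ C and e_{i_j}' ∈ C for every 1 ≤ j ≤ k. -/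
open Filter Topology

theorem approx_zero {V : Type*} [NormedAddCommGroup V] [InnerProductSpace ℝ V]
    (T : V →ₗ[ℝ] V) (s : Finset ℝ) (l : ℝ) (hs : ∀ x ∈ s, 0 < x) (hl : ∀ x ∈ s, x < l) (u : V)
    (hu : u ∈ ⨆ μ ∈ s, Module.End.eigenspace T μ) :
    Tendsto (fun n : ℕ => (T ^ n) ((l⁻¹ ^ n) • u)) atTop (𝓝 0) := by
  induction hu using Submodule.iSup_induction' with
  | zero => simp
  | add x y _ _ hx hy => simpa using hx.add hy
  | mem μ x hx =>
    by_cases hμ : μ ∈ s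
    · simp only [hμ, iSup_pos] at hx
      have h1 : ∀ n : ℕ, (T ^ n) x = μ ^ n • x := by
        intro n
        induction n with
        | zero => simp
        | succ n ih =>
          rw [pow_succ', Module.End.mul_apply, ih, map_smul, Module.End.mem_eigenspace_iff.1 hx,
            smul_smul, pow_succ]
      have h2 : ∀ n : ℕ, (T ^ n) ((l⁻¹ ^ n) • x) = ((l⁻¹ * μ) ^ n) • x := by
        intro n
        rw [map_smul, h1, smul_smul, mul_pow]
      simp only [h2]
      have h0 := hs μ hμ
      have h3 := hl μ hμ
      have : Tendsto (fun n : ℕ => (l⁻¹ * μ) ^ n) atTop (𝓝 0) := by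
        apply tendsto_pow_atTop_nhds_zero_of_lt_one
        · have := h0.trans h3; positivity
        · rw [inv_mul_lt_iff₀ (h0.trans h3)]; linarith
      simpa using this.smul_const x
    · simp only [hμ, iSup_false] at hx
      simp at hx
      simp [hx]

theorem approx_inv {V : Type*} [NormedAddCommGroup V] [InnerProductSpace ℝ V]
    [FiniteDimensional ℝ V] (T : V →ₗ[ℝ] V) (hT : T.IsSymmetric) (s : Finset ℝ) :
    (∀ x ∈ s, 0 < x) → ∀ E : Submodule ℝ V, E ≤ (⨆ μ ∈ s, Module.End.eigenspace T μ) →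
    ∃ E' : Submodule ℝ V, E' ≤ (⨆ μ ∈ s, Module.End.eigenspace T μ) ∧
      Module.finrank ℝ E' = Module.finrank ℝ E ∧ (∀ x ∈ E', T x ∈ E') ∧
      ∀ w ∈ E', ∃ v : ℕ → V, (∀ n, v n ∈ E) ∧
        Tendsto (fun n => (T ^ n) (v n)) atTop (𝓝 w) := by
  induction s using Finset.induction_on_max with
  | empty =>
    intro _ E hE
    simp at hE
    subst hE
    refine ⟨⊥, by simp, rfl, by simp, ?_⟩
    intro w hw
    simp at hw
    exact ⟨fun _ => 0, by simp, by simp [hw]⟩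
  | insert l s hl ih =>
    intro hpos E hE
    have hs : ∀ x ∈ s, 0 < x := fun x hx => hpos x (Finset.mem_insert_of_mem hx)
    have hl0 : 0 < l := hpos l (Finset.mem_insert_self _ _)
    rw [Finset.iSup_insert] at hE ⊢
    set F := ⨆ μ ∈ s, Module.End.eigenspace T μ with hF
    set G := Module.End.eigenspace T l with hG
    have horth : F ≤ Gᗮ := by
      refine iSup₂_le fun μ hμ => ?_
      intro x hx
      rw [Submodule.mem_orthogonal]
      intro y hy
      exact hT.orthogonalFamily_eigenspaces (hl μ hμ).ne' ⟨y, hy⟩ ⟨x, hx⟩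
    set P : V →ₗ[ℝ] V := G.starProjection.toLinearMap with hP
    have hPF : ∀ u ∈ F, P u = 0 := fun u hu => by
      simpa [P] using (Submodule.starProjection_apply_eq_zero_iff G).2 (horth hu)
    have hPG : ∀ a ∈ G, P a = a := fun a ha => by
      simpa [P] using Submodule.starProjection_eq_self_iff.2 ha
    have hPm : ∀ a, P a ∈ G := fun a => by simp [P]
    have hdec : ∀ v ∈ E, v - P v ∈ F := by
      intro v hv
      obtain ⟨a, ha, u, hu, rfl⟩ := Submodule.mem_sup.1 (hE hv)
      rw [map_add, hPF u hu, hPG a ha]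
      simpa using hu
    obtain ⟨E1, h1F, h1r, h1T, h1a⟩ := ih hs (E ⊓ F) inf_le_right
    have hdisj : Disjoint E1 (E.map P) := by
      rw [Submodule.disjoint_def]
      rintro x hx ⟨y, -, rfl⟩
      rw [← hPG _ (hPm y)]
      exact hPF _ (h1F hx)
    refine ⟨E1 ⊔ E.map P, ?_, ?_, ?_, ?_⟩
    · refine sup_le (h1F.trans le_sup_right) (le_trans ?_ le_sup_left)
      rintro _ ⟨y, -, rfl⟩
      exact hPm y
    · have h := Submodule.finrank_sup_add_finrank_inf_eq E1 (E.map P)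
      rw [hdisj.eq_bot, finrank_bot, add_zero, h1r] at h
      rw [h]
      have h2 := LinearMap.finrank_range_add_finrank_ker (P.domRestrict E)
      have h3 : LinearMap.range (P.domRestrict E) = E.map P := by
        ext x; simp
      have h4 : Module.finrank ℝ (LinearMap.ker (P.domRestrict E)) = Module.finrank ℝ ↥(E ⊓ F) := by
        have : E ⊓ F = (LinearMap.ker (P.domRestrict E)).map E.subtype := by
          ext x
          simp only [Submodule.mem_inf, Submodule.mem_map, LinearMap.mem_ker, Subtype.exists,
            LinearMap.domRestrict_apply, Submodule.subtype_apply]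
          constructor
          · rintro ⟨a, b⟩
            exact ⟨x, a, hPF x b, rfl⟩
          · rintro ⟨y, a, b, rfl⟩
            refine ⟨a, ?_⟩
            have := hdec y a
            rwa [b, sub_zero] at this
        rw [this]
        exact (Submodule.finrank_map_subtype_eq _ _).symm
      rw [h3, h4] at h2
      omega
    · intro x hx
      obtain ⟨a, ha, b, hb, rfl⟩ := Submodule.mem_sup.1 hx
      rw [map_add]
      refine add_mem (Submodule.mem_sup_left (h1T a ha)) (Submodule.mem_sup_right ?_)
      obtain ⟨y, hy, rfl⟩ := hb
      rw [Module.End.mem_eigenspace_iff.1 (hPm y)]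
      exact Submodule.smul_mem _ _ ⟨y, hy, rfl⟩
    · intro w hw
      obtain ⟨a, ha, b, hb, rfl⟩ := Submodule.mem_sup.1 hw
      obtain ⟨y, hy, rfl⟩ := hb
      obtain ⟨v, hv, hvt⟩ := h1a a ha
      refine ⟨fun n => v n + l⁻¹ ^ n • y, fun n => add_mem (hv n).1 (E.smul_mem _ hy), ?_⟩
      simp only [map_add]
      refine hvt.add ?_
      have hz := approx_zero T s l hs hl _ (hdec y hy)
      have hc : ∀ n : ℕ, (T ^ n) (l⁻¹ ^ n • P y) = P y := by
        intro n
        induction n with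
        | zero => simp
        | succ n ih =>
          rw [pow_succ, Module.End.mul_apply, map_smul, Module.End.mem_eigenspace_iff.1 (hPm y),
            smul_smul, pow_succ, mul_assoc, inv_mul_cancel₀ hl0.ne', mul_one, ih]
      have := hz.add_const (P y)
      rw [zero_add] at this
      refine this.congr fun n => ?_
      nth_rw 2 [← hc n]
      rw [← map_add, ← smul_add, sub_add_cancel]

theorem approx_inv_top {V : Type*} [NormedAddCommGroup V] [InnerProductSpace ℝ V]
    [FiniteDimensional ℝ V] (T : V →ₗ[ℝ] V) (hT : T.IsSymmetric)
    (hpos : ∀ v, v ≠ 0 → 0 < inner ℝ (T v) v) (E : Submodule ℝ V) :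
    ∃ E' : Submodule ℝ V,
      Module.finrank ℝ E' = Module.finrank ℝ E ∧ (∀ x ∈ E', T x ∈ E') ∧
      ∀ w ∈ E', ∃ v : ℕ → V, (∀ n, v n ∈ E) ∧
        Tendsto (fun n => (T ^ n) (v n)) atTop (𝓝 w) := by
  have hb := hT.apply_eigenvectorBasis (n := Module.finrank ℝ V) rfl
  set b := hT.eigenvectorBasis (n := Module.finrank ℝ V) rfl
  set μ := hT.eigenvalues (n := Module.finrank ℝ V) rfl
  obtain ⟨E', -, h⟩ := approx_inv T hT (Finset.univ.image μ) (by
    intro x hx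
    obtain ⟨i, -, rfl⟩ := Finset.mem_image.1 hx
    have h0 : b i ≠ 0 := b.orthonormal.ne_zero i
    have := hpos (b i) h0
    rw [hb, real_inner_smul_left, real_inner_self_eq_norm_sq, b.orthonormal.1 i] at this
    simpa using this) E (by
    intro v _
    rw [← b.sum_repr v]
    refine Submodule.sum_mem _ fun i _ => Submodule.smul_mem _ _ ?_
    refine Submodule.mem_iSup_of_mem (μ i) (Submodule.mem_iSup_of_mem (by simp) ?_)
    rw [Module.End.mem_eigenspace_iff, hb]
    rfl)
  exact ⟨E', h⟩

theorem fr {V : Type*} [NormedAddCommGroup V] [InnerProductSpace ℝ V]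
    (T : V →ₗ[ℝ] V) (E : Submodule ℝ V) (h : Function.Injective T) :
    Module.finrank ℝ (E.map T) = Module.finrank ℝ E :=
  (Submodule.equivMapOfInjective T h E).finrank_eq.symm

theorem exists_onb {V : Type*} [NormedAddCommGroup V] [InnerProductSpace ℝ V]
    [FiniteDimensional ℝ V] {d : ℕ} (hd : Module.finrank ℝ V = d) (f : Fin d → V)
    (hf : Orthonormal ℝ f) : ∃ b : OrthonormalBasis (Fin d) ℝ V, ⇑b = f :=
  ⟨OrthonormalBasis.mk hf
    (hf.linearIndependent.span_eq_top_of_card_eq_finrank' (by simp [hd])).ge, by simp⟩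

/-- An invariant subspace is spanned by part of a sorted orthonormal eigenbasis. -/
theorem sorted_eigenbasis {V : Type*} [NormedAddCommGroup V] [InnerProductSpace ℝ V]
    [FiniteDimensional ℝ V] (T : V →ₗ[ℝ] V) (hT : T.IsSymmetric) (d k : ℕ)
    (hd : Module.finrank ℝ V = d) (E : Submodule ℝ V) (hE : Module.finrank ℝ E = k)
    (hinv : ∀ x ∈ E, T x ∈ E) :
    ∃ (μ : Fin d → ℝ) (e : OrthonormalBasis (Fin d) ℝ V), Antitone μ ∧
      (∀ i, T (e i) = μ i • e i) ∧ ∃ ι : Fin k → Fin d, StrictMono ι ∧ ∀ j, e (ι j) ∈ E := by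
  have hinv' : ∀ x ∈ Eᗮ, T x ∈ Eᗮ := by
    intro x hx
    rw [Submodule.mem_orthogonal] at hx ⊢
    intro u hu
    rw [← hT]
    exact hx _ (hinv u hu)
  have hd' : Module.finrank ℝ Eᗮ = d - k := by
    have := Submodule.finrank_add_finrank_orthogonal E
    omega
  have hkd : k ≤ d := by
    have := Submodule.finrank_le E
    omega
  have hT1 := hT.restrict_invariant hinv
  have hT2 := hT.restrict_invariant hinv'
  have hb1 := hT1.apply_eigenvectorBasis hE
  have hb2 := hT2.apply_eigenvectorBasis hd'
  set b1 := hT1.eigenvectorBasis hE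
  set b2 := hT2.eigenvectorBasis hd'
  set m1 := hT1.eigenvalues hE
  set m2 := hT2.eigenvalues hd'
  let f : Fin k ⊕ Fin (d - k) → V := Sum.elim (fun i => (b1 i : V)) (fun i => (b2 i : V))
  let m : Fin k ⊕ Fin (d - k) → ℝ := Sum.elim m1 m2
  have hfo : Orthonormal ℝ f := by
    constructor
    · rintro (i | i)
      · exact b1.orthonormal.1 i
      · exact b2.orthonormal.1 i
    · rintro (i | i) (j | j) hij
      · simpa [f] using b1.orthonormal.2 (i := i) (j := j) (by simpa using hij)
      · exact Submodule.inner_right_of_mem_orthogonal (b1 i).2 (b2 j).2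
      · exact Submodule.inner_left_of_mem_orthogonal (b1 j).2 (b2 i).2
      · simpa [f] using b2.orthonormal.2 (i := i) (j := j) (by simpa using hij)
  have hfm : ∀ i, T (f i) = m i • f i := by
    rintro (i | i)
    · simpa [f, m] using congrArg Subtype.val (hb1 i)
    · simpa [f, m] using congrArg Subtype.val (hb2 i)
  let q : Fin d ≃ Fin k ⊕ Fin (d - k) :=
    (finCongr (by omega : d = k + (d - k))).trans finSumFinEquiv.symm
  let t : Fin d ≃ Fin k ⊕ Fin (d - k) := (Tuple.sort (fun i => - m (q i))).trans q
  have hto : Orthonormal ℝ (fun i => f (t i)) := hfo.comp t t.injective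
  have hmono := Tuple.monotone_sort (fun i => - m (q i))
  obtain ⟨e, he⟩ := exists_onb hd _ hto
  have hcard : (Finset.univ.image fun j : Fin k => t.symm (Sum.inl j)).card = k := by
    rw [Finset.card_image_of_injective (f := fun j : Fin k => t.symm (Sum.inl j)) _ (t.symm.injective.comp Sum.inl_injective)]
    simp
  refine ⟨fun i => m (t i), e, ?_, ?_, Finset.orderEmbOfFin _ hcard,
    (Finset.orderEmbOfFin _ hcard).strictMono, ?_⟩
  · intro i j hij
    have := hmono hij
    simp only [Function.comp_apply, neg_le_neg_iff] at this
    exact this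
  · intro i
    rw [he]
    exact hfm _
  · intro j
    obtain ⟨l, -, hl⟩ := Finset.mem_image.1 (Finset.orderEmbOfFin_mem _ hcard j)
    rw [he, ← hl]
    simp [f]

open Matrix
theorem statement16 (d k : ℕ) (hk1 : 1 ≤ k) (hkd : k < d)
    (C : Set (EuclideanSpace ℝ (Fin d))) (hclosed : IsClosed C)
    (hcone : ∀ (s : ℝ), ∀ v ∈ C, s • v ∈ C)
    (hsub : ∃ E₀ : Submodule ℝ (EuclideanSpace ℝ (Fin d)),
      Module.finrank ℝ E₀ = k ∧ (E₀ : Set (EuclideanSpace ℝ (Fin d))) ⊆ C)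
    (A : Matrix (Fin d) (Fin d) ℝ) (hA : IsUnit A)
    (hinv : ∀ E : Submodule ℝ (EuclideanSpace ℝ (Fin d)),
      Module.finrank ℝ E = k → (E : Set (EuclideanSpace ℝ (Fin d))) ⊆ C →
        (Matrix.toEuclideanLin A '' E ⊆ C ∧ Matrix.toEuclideanLin Aᵀ '' E ⊆ C)) :
    ∃ (σ : Fin d → ℝ) (e e' : OrthonormalBasis (Fin d) ℝ (EuclideanSpace ℝ (Fin d))),
      Antitone σ ∧ (∀ i, 0 < σ i) ∧
      (∀ i, Matrix.toEuclideanLin A (e i) = σ i • e' i) ∧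
      ∃ ι : Fin k → Fin d, StrictMono ι ∧ ∀ j, e (ι j) ∈ C ∧ e' (ι j) ∈ C := by
  have hadj : ∀ x y, inner ℝ (toEuclideanLin Aᵀ x) y = inner ℝ x (toEuclideanLin A y) := by
    intro x y
    have := Matrix.toEuclideanLin_conjTranspose_eq_adjoint A
    rw [Matrix.conjTranspose_eq_transpose_of_trivial] at this
    rw [this, LinearMap.adjoint_inner_left]
  have hinj : ∀ B : Matrix (Fin d) (Fin d) ℝ, IsUnit B →
      Function.Injective (toEuclideanLin B) := by
    intro B hB x y hxy
    have h1 : B *ᵥ x.ofLp = B *ᵥ y.ofLp := congrArg WithLp.ofLp hxy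
    exact WithLp.ofLp_injective 2 (Matrix.mulVec_injective_of_isUnit hB h1)
  have hAt : IsUnit Aᵀ := (Matrix.isUnit_transpose A).2 hA
  have hi := hinj A hA
  have hit := hinj Aᵀ hAt
  set L := toEuclideanLin A with hL
  set Lt := toEuclideanLin Aᵀ with hLt
  set T := Lt ∘ₗ L with hTdef
  have hTin : ∀ x y, inner ℝ (T x) y = inner ℝ (L x) (L y) := fun x y => by
    simp [T, hadj]
  have hT : T.IsSymmetric := by
    intro x y
    rw [hTin, real_inner_comm, ← hTin, real_inner_comm]
  have hpos : ∀ v, v ≠ 0 → 0 < inner ℝ (T v) v := by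
    intro v hv
    rw [hTin, real_inner_self_eq_norm_sq]
    have : L v ≠ 0 := fun h => hv (hi (by simpa using h))
    positivity
  obtain ⟨E₀, hE₀, hE₀C⟩ := hsub
  have hiter : ∀ n : ℕ, Module.finrank ℝ (E₀.map (T ^ n)) = k ∧
      ((E₀.map (T ^ n) : Submodule ℝ (EuclideanSpace ℝ (Fin d))) : Set _) ⊆ C := by
    intro n
    induction n with
    | zero => 
      have : E₀.map (T ^ 0) = E₀ := by ext x; simp
      rw [this]; exact ⟨hE₀, hE₀C⟩
    | succ n ih =>
      obtain ⟨h1, h2⟩ := ih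
      have h3 : E₀.map (T ^ (n + 1)) = ((E₀.map (T ^ n)).map L).map Lt := by
        rw [← Submodule.map_comp, ← Submodule.map_comp, pow_succ']
        rfl
      have h4 : Module.finrank ℝ ((E₀.map (T ^ n)).map L) = k := by
        rw [fr _ _ hi, h1]
      have h5 : (((E₀.map (T ^ n)).map L : Submodule ℝ (EuclideanSpace ℝ (Fin d))) : Set _) ⊆ C := by
        rw [Submodule.map_coe]; exact (hinv _ h1 h2).1
      rw [h3]
      refine ⟨by rw [fr _ _ hit, h4], ?_⟩
      rw [Submodule.map_coe]; exact (hinv _ h4 h5).2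
  obtain ⟨E, hE, hET, hEa⟩ := approx_inv_top T hT hpos E₀
  rw [hE₀] at hE
  have hEC : (E : Set (EuclideanSpace ℝ (Fin d))) ⊆ C := by
    intro w hw
    obtain ⟨v, hv, hvt⟩ := hEa w hw
    exact hclosed.mem_of_tendsto hvt
      (Eventually.of_forall fun n => (hiter n).2 (Submodule.mem_map_of_mem (hv n)))
  obtain ⟨μ, e, hμ, heμ, ι, hι, hιE⟩ := sorted_eigenbasis T hT d k (by simp) E hE hET
  have hμpos : ∀ i, 0 < μ i := by
    intro i
    have := hpos (e i) (e.orthonormal.ne_zero i)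
    rw [heμ, real_inner_smul_left, real_inner_self_eq_norm_sq, e.orthonormal.1 i] at this
    simpa using this
  have hs : ∀ i, 0 < √(μ i) := fun i => Real.sqrt_pos.2 (hμpos i)
  have hin : ∀ i j, inner ℝ (L (e i)) (L (e j)) = if i = j then μ i else 0 := by
    intro i j
    rw [← hTin, heμ, real_inner_smul_left, orthonormal_iff_ite.1 e.orthonormal i j]
    simp
  have ho : Orthonormal ℝ (fun i => (√(μ i))⁻¹ • L (e i)) := by
    rw [orthonormal_iff_ite]
    intro i j
    rw [real_inner_smul_left, real_inner_smul_right, hin]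
    split_ifs with h
    · subst h
      have := Real.mul_self_sqrt (hμpos i).le
      have := hs i
      field_simp
      nlinarith
    · simp
  obtain ⟨e', he'⟩ := exists_onb (by simp) _ ho
  refine ⟨fun i => √(μ i), e, e', fun i j hij => Real.sqrt_le_sqrt (hμ hij), hs, ?_, ι, hι, ?_⟩
  · intro i
    simp only [he']
    rw [smul_smul, mul_inv_cancel₀ (hs i).ne', one_smul]
  · intro j
    refine ⟨hEC (hιE j), ?_⟩
    rw [he']
    exact hcone _ _ ((hinv E hE hEC).1 ⟨_, hιE j, rfl⟩)
end
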